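/- arXiv:2203.00646 — 3 statements merged into one kernel-verified Lean document; each statement's English description precedes it below -/
import Mathlib

section
/- Fix an integer $n\ge 2$, positive integers $e_1,\dots,e_{n-1}$, and an index $1\le i\le n-1$. For each prime $p$, let $N(p)$ be the number of tuples of integers $(a_{rs})_{1\le r<s\le i}$ with $0\le a_{rs}<p^{e_r-1}$ such that the componentwise product $v_i\circ v_i$ lies in the $\mathbb{Z}$-span of the columns of the associated matrix $A$. Then there exists a polynomial $P$ with rational coefficients such that $N(p)=P(p)$ for every prime $p$. -/
/-- The `(m+1) × (m+1)` integer matrix associated to a prime `p`, composition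
`e = (e₁, …, e_m)` of positive integers, and a family of above-diagonal parameters
`a : Fin m → Fin m → ℤ`: it is upper triangular with diagonal `(p^{e₁}, …, p^{e_m}, 1)`,
last column `(1, …, 1)ᵀ`, and entry `p · a r s` in position `(r, s)` for `r < s < m`. -/
def assocMatrix (p : ℕ) {m : ℕ} (e : Fin m → ℕ) (a : Fin m → Fin m → ℤ) :
    Matrix (Fin (m + 1)) (Fin (m + 1)) ℤ :=
  Matrix.of fun r s =>
    if hs : (s : ℕ) = m then 1
    else if hrs : (r : ℕ) = (s : ℕ) then
      (p : ℤ) ^ e ⟨(s : ℕ), by have := s.isLt; omega⟩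
    else if hlt : (r : ℕ) < (s : ℕ) then
      (p : ℤ) * a ⟨(r : ℕ), by have := s.isLt; omega⟩ ⟨(s : ℕ), by have := s.isLt; omega⟩
    else 0

/-- Integer vectors with coordinates in `[0, q)` on `S` and zero elsewhere. -/
noncomputable def coordBox {ι : Type*} [Fintype ι] [DecidableEq ι] (S : Finset ι) (q : ℤ) :
    Finset (ι → ℤ) :=
  Fintype.piFinset fun s => if s ∈ S then Finset.Ico 0 q else {0}

lemma sum_piFinset_update {ι α M : Type*} [Fintype ι] [DecidableEq ι] [DecidableEq α]
    [AddCommMonoid M] (A : ι → Finset α) (k : ι) (z : α) (F : (ι → α) → M) :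
    ∑ a ∈ Fintype.piFinset A, F a =
      ∑ b ∈ A k, ∑ a ∈ Fintype.piFinset (Function.update A k {z}),
        F (Function.update a k b) := by
  rw [← Finset.sum_product']
  refine Finset.sum_bij' (fun a _ => (a k, Function.update a k z))
    (fun x _ => Function.update x.2 k x.1) ?_ ?_ ?_ ?_ ?_
  · intro a ha
    rw [Fintype.mem_piFinset] at ha
    refine Finset.mem_product.2 ⟨ha k, Fintype.mem_piFinset.2 fun s => ?_⟩
    by_cases h : s = k
    · subst h; simp
    · simpa [h] using ha s
  · intro x hx
    obtain ⟨h1, h2⟩ := Finset.mem_product.1 hx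
    rw [Fintype.mem_piFinset] at h2 ⊢
    intro s
    by_cases h : s = k
    · subst h; simpa using h1
    · simpa [h] using h2 s
  · intro a ha
    simp
  · intro x hx
    obtain ⟨h1, h2⟩ := Finset.mem_product.1 hx
    have h3 := Fintype.mem_piFinset.1 h2 k
    simp only [Function.update_self, Finset.mem_singleton] at h3
    ext1
    · simp
    · simp [← h3]
  · intro a ha
    simp

lemma sum_coordBox_insert {ι M : Type*} [Fintype ι] [DecidableEq ι] [AddCommMonoid M]
    {S : Finset ι} {k : ι} (hk : k ∉ S) (q : ℤ) (F : (ι → ℤ) → M) :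
    ∑ a ∈ coordBox (insert k S) q, F a =
      ∑ b ∈ Finset.Ico 0 q, ∑ a ∈ coordBox S q, F (Function.update a k b) := by
  unfold coordBox
  rw [sum_piFinset_update _ k 0]
  have : Function.update (fun s => if s ∈ insert k S then Finset.Ico 0 q else {0}) k {0} =
      fun s => if s ∈ S then Finset.Ico 0 q else {0} := by
    ext1 s
    by_cases h : s = k
    · subst h; simp [hk]
    · simp [h]
  rw [this]
  simp

lemma card_coordBox {ι : Type*} [Fintype ι] [DecidableEq ι] (S : Finset ι) (q : ℕ) :
    (coordBox S (q : ℤ)).card = q ^ S.card := by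
  unfold coordBox
  rw [Fintype.card_piFinset]
  have : ∀ s, (if s ∈ S then Finset.Ico 0 (q : ℤ) else {0}).card = if s ∈ S then q else 1 := by
    intro s; split_ifs <;> simp
  simp [this, Finset.prod_ite_mem]

lemma card_Ico_modEq_pow {p : ℕ} (hp : p.Prime) {f j : ℕ} (hj : j ≤ f) (v : ℤ) :
    ((Finset.Ico (0 : ℤ) ((p : ℤ) ^ f)).filter fun b => b ≡ v [ZMOD (p : ℤ) ^ j]).card =
      p ^ (f - j) := by
  have hpos : (0 : ℤ) < (p : ℤ) ^ j := pow_pos (by exact_mod_cast hp.pos) _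
  have h := Int.Ico_filter_modEq_card (a := 0) (b := (p : ℤ) ^ f) hpos v
  have hq : (((p : ℤ) ^ j : ℤ) : ℚ) ≠ 0 := by exact_mod_cast hpos.ne'
  have e1 : ((((p : ℤ) ^ f : ℤ) : ℚ) - (v : ℚ)) / (((p : ℤ) ^ j : ℤ) : ℚ) =
      (((0 : ℤ) : ℚ) - v) / (((p : ℤ) ^ j : ℤ) : ℚ) + (((p : ℤ) ^ (f - j) : ℤ) : ℚ) := by
    rw [show f = (f - j) + j by omega, Nat.add_sub_cancel, pow_add]
    push_cast at hq ⊢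
    field_simp
    ring
  rw [e1, Int.ceil_add_intCast, add_sub_cancel_left, max_eq_left (by positivity)] at h
  exact_mod_cast h

lemma card_Ico_pow_dvd {p : ℕ} (hp : p.Prime) {f d h : ℕ} (hd : d ≤ f) (t u : ℤ)
    (hu : ¬ (p : ℤ) ∣ u) :
    ((Finset.Ico (0 : ℤ) ((p : ℤ) ^ f)).filter fun b =>
        (p : ℤ) ^ (f + h) ∣ t - b * ((p : ℤ) ^ (h + d) * u)).card =
      if (p : ℤ) ^ (h + d) ∣ t then p ^ d else 0 := by
  have hp0 : (p : ℤ) ≠ 0 := by exact_mod_cast hp.ne_zero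
  split_ifs with ht
  · obtain ⟨t, rfl⟩ := ht
    have hcop : IsCoprime u ((p : ℤ) ^ (f - d)) :=
      ((Nat.prime_iff_prime_int.1 hp).coprime_iff_not_dvd.2 hu).symm.pow_right
    obtain ⟨v, w, hvw⟩ := hcop
    have := card_Ico_modEq_pow hp (Nat.sub_le f d) (v * t)
    rw [Nat.sub_sub_self hd] at this
    rw [← this]
    congr 1
    refine Finset.filter_congr fun b _ => ?_
    rw [show f + h = (h + d) + (f - d) by omega, pow_add,
      show (p : ℤ) ^ (h + d) * t - b * ((p : ℤ) ^ (h + d) * u) =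
        (p : ℤ) ^ (h + d) * (t - b * u) by ring,
      mul_dvd_mul_iff_left (pow_ne_zero _ hp0), Int.modEq_iff_dvd]
    constructor
    · rintro ⟨c, hc⟩
      exact ⟨v * c - b * w, by linear_combination v * hc + b * hvw⟩
    · rintro ⟨c, hc⟩
      exact ⟨u * c + w * t, by linear_combination u * hc - t * hvw⟩
  · rw [Finset.card_eq_zero, Finset.filter_eq_empty_iff]
    intro b _ hb
    apply ht
    have h1 : (p : ℤ) ^ (h + d) ∣ t - b * ((p : ℤ) ^ (h + d) * u) :=
      (pow_dvd_pow _ (by omega)).trans hb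
    have h2 : (p : ℤ) ^ (h + d) ∣ b * ((p : ℤ) ^ (h + d) * u) := ⟨b * u, by ring⟩
    simpa using dvd_add h1 h2

/-- The number of solutions in a box of a linear congruence modulo `p ^ (f + h)` whose
coefficients have greatest common divisor `p ^ (h + d)` with the modulus. -/
lemma card_coordBox_pow_dvd {ι : Type*} [Fintype ι] [DecidableEq ι] {p : ℕ} (hp : p.Prime)
    {f d h : ℕ} (hd : d ≤ f) (S : Finset ι) (y : ι → ℤ)
    (hy : ∀ s ∈ S, (p : ℤ) ^ (h + d) ∣ y s)
    (hy' : d = f ∨ ¬ ∀ s ∈ S, (p : ℤ) ^ (h + d + 1) ∣ y s) (t : ℤ) :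
    ((coordBox S ((p : ℤ) ^ f)).filter fun b =>
        (p : ℤ) ^ (f + h) ∣ t - ∑ s ∈ S, b s * y s).card =
      if (p : ℤ) ^ (h + d) ∣ t then p ^ (f * S.card + d - f) else 0 := by
  have key : ∀ (T : Finset ι) (b : ι → ℤ), T ⊆ S →
      (p : ℤ) ^ (h + d) ∣ ∑ s ∈ T, b s * y s := fun T b hT =>
    Finset.dvd_sum fun s hs => (hy s (hT hs)).mul_left _
  rcases eq_or_ne d f with rfl | hdf
  · have : ∀ b ∈ coordBox S ((p : ℤ) ^ d),
        ((p : ℤ) ^ (d + h) ∣ t - ∑ s ∈ S, b s * y s ↔ (p : ℤ) ^ (h + d) ∣ t) := by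
      intro b _
      rw [add_comm d h]
      exact dvd_sub_left (key S b subset_rfl)
    rw [Finset.filter_congr this]
    split_ifs with ht
    · simp only [ht, Finset.filter_true, Nat.add_sub_cancel, pow_mul]
      exact_mod_cast card_coordBox S (p ^ d)
    · simp [ht]
  · have hy'' := hy'.resolve_left hdf
    push Not at hy''
    obtain ⟨k, hk, hky⟩ := hy''
    obtain ⟨u, hu⟩ := hy k hk
    have hpu : ¬ (p : ℤ) ∣ u := by
      rintro ⟨w, rfl⟩
      exact hky ⟨w, by rw [hu]; ring⟩
    obtain ⟨T, hkT, rfl⟩ : ∃ T, k ∉ T ∧ insert k T = S :=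
      ⟨S.erase k, by simp, Finset.insert_erase hk⟩
    rw [Finset.card_filter, sum_coordBox_insert hkT, Finset.sum_comm]
    have inner : ∀ b ∈ coordBox T ((p : ℤ) ^ f),
        (∑ x ∈ Finset.Ico 0 ((p : ℤ) ^ f), if (p : ℤ) ^ (f + h) ∣
          t - ∑ s ∈ insert k T, Function.update b k x s * y s then 1 else 0) =
        if (p : ℤ) ^ (h + d) ∣ t then p ^ d else 0 := by
      intro b _
      have e1 : ∀ x, t - ∑ s ∈ insert k T, Function.update b k x s * y s =
          (t - ∑ s ∈ T, b s * y s) - x * ((p : ℤ) ^ (h + d) * u) := by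
        intro x
        rw [Finset.sum_insert hkT, Function.update_self, hu]
        have : ∑ s ∈ T, Function.update b k x s * y s = ∑ s ∈ T, b s * y s :=
          Finset.sum_congr rfl fun s hs => by
            rw [Function.update_of_ne (ne_of_mem_of_not_mem hs hkT)]
        rw [this]; ring
      simp only [e1]
      rw [← Finset.card_filter, card_Ico_pow_dvd hp hd _ _ hpu]
      simp only [dvd_sub_left (key T b (Finset.subset_insert _ _))]
    rw [Finset.sum_congr rfl inner, Finset.sum_const, smul_eq_mul]
    have hc := card_coordBox T (p ^ f)
    push_cast at hc
    rw [hc, Finset.card_insert_of_notMem hkT]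
    split_ifs
    · rw [← pow_mul, ← pow_add]
      congr 1
      rw [mul_add]
      omega
    · simp

lemma card_Ico_pow_dvd_self {p : ℕ} (hp : p.Prime) (f j : ℕ) :
    ((Finset.Ico (0 : ℤ) ((p : ℤ) ^ f)).filter fun b => (p : ℤ) ^ j ∣ b).card =
      p ^ (f - j) := by
  rcases le_total j f with hj | hj
  · rw [← card_Ico_modEq_pow hp hj 0]
    congr 1
    exact Finset.filter_congr fun b _ => (Int.modEq_zero_iff_dvd).symm
  · rw [Nat.sub_eq_zero_of_le hj, pow_zero, Finset.card_eq_one]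
    refine ⟨0, ?_⟩
    ext b
    simp only [Finset.mem_filter, Finset.mem_Ico, Finset.mem_singleton]
    constructor
    · rintro ⟨⟨h0, h1⟩, h2⟩
      exact Int.eq_zero_of_dvd_of_nonneg_of_lt h0
        (h1.trans_le (pow_le_pow_right₀ (by exact_mod_cast hp.one_le) hj)) h2
    · rintro rfl
      exact ⟨⟨le_rfl, pow_pos (by exact_mod_cast hp.pos) _⟩, dvd_zero _⟩

lemma card_Ico_pow_dvd_sub_pow {p : ℕ} (hp : p.Prime) {f j c : ℕ} (hc : c < j) :
    ((Finset.Ico (0 : ℤ) ((p : ℤ) ^ f)).filter fun b => (p : ℤ) ^ j ∣ b - (p : ℤ) ^ c).card =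
      if c < f then p ^ (f - j) else 0 := by
  have hp1 : (1 : ℤ) < p := by exact_mod_cast hp.one_lt
  rcases le_total j f with hj | hj
  · rw [if_pos (by omega), ← card_Ico_modEq_pow hp hj ((p : ℤ) ^ c)]
    congr 1
    exact Finset.filter_congr fun b _ => by rw [Int.modEq_comm, Int.modEq_iff_dvd]
  · have key : ∀ b ∈ Finset.Ico (0 : ℤ) ((p : ℤ) ^ f),
        ((p : ℤ) ^ j ∣ b - (p : ℤ) ^ c ↔ b = (p : ℤ) ^ c) := by
      intro b hb
      rw [Finset.mem_Ico] at hb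
      constructor
      · intro h
        have h1 : b < (p : ℤ) ^ j := hb.2.trans_le (pow_le_pow_right₀ hp1.le hj)
        have h2 : (p : ℤ) ^ c < (p : ℤ) ^ j := pow_lt_pow_right₀ hp1 hc
        have h3 : (0 : ℤ) < (p : ℤ) ^ c := pow_pos (by omega) _
        have := Int.eq_zero_of_abs_lt_dvd h (abs_lt.2 ⟨by linarith [hb.1], by linarith⟩)
        linarith
      · rintro rfl; simp
    rw [Finset.filter_congr key, Finset.filter_eq']
    have hiff : (p : ℤ) ^ c ∈ Finset.Ico (0 : ℤ) ((p : ℤ) ^ f) ↔ c < f := by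
      rw [Finset.mem_Ico, pow_lt_pow_iff_right₀ hp1]
      exact and_iff_right (pow_nonneg (by omega) _)
    simp only [hiff]
    split_ifs
    · simp [Nat.sub_eq_zero_of_le hj]
    · simp

lemma Int.pow_dvd_mul_sub_pow_of_le {p : ℕ} (hp : p.Prime) {j c : ℕ} (hj : j ≤ 2 * c)
    (a : ℤ) :
    (p : ℤ) ^ j ∣ a * (a - (p : ℤ) ^ c) ↔ (p : ℤ) ^ ((j + 1) / 2) ∣ a := by
  have hp' := Nat.prime_iff_prime_int.1 hp
  constructor
  · intro h
    by_contra hn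
    obtain ⟨l, hl, hl1, hl2⟩ : ∃ l, l < (j + 1) / 2 ∧ (p : ℤ) ^ l ∣ a ∧
        ¬ (p : ℤ) ^ (l + 1) ∣ a := by
      by_contra! hcon
      apply hn
      have : ∀ l ≤ (j + 1) / 2, (p : ℤ) ^ l ∣ a := by
        intro l
        induction l with
        | zero => simp
        | succ l ih => exact fun hl => hcon l (by omega) (ih (by omega))
      exact this _ le_rfl
    obtain ⟨u, rfl⟩ := hl1
    have hu : ¬ (p : ℤ) ∣ u := fun ⟨w, hw⟩ => hl2 ⟨w, by rw [hw]; ring⟩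
    have hcl : c = l + 1 + (c - l - 1) := by omega
    have e1 : (p : ℤ) ^ l * u * ((p : ℤ) ^ l * u - (p : ℤ) ^ c) =
        (p : ℤ) ^ (2 * l) * (u * (u - p * (p : ℤ) ^ (c - l - 1))) := by
      rw [hcl, show l + 1 + (c - l - 1) - l - 1 = c - l - 1 by omega]
      ring
    rw [e1] at h
    have h2 : (p : ℤ) ^ (2 * l) * p ∣
        (p : ℤ) ^ (2 * l) * (u * (u - p * (p : ℤ) ^ (c - l - 1))) := by
      rw [← pow_succ]
      exact (pow_dvd_pow _ (by omega)).trans h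
    rw [mul_dvd_mul_iff_left (pow_ne_zero _ hp'.ne_zero)] at h2
    rcases hp'.dvd_or_dvd h2 with h3 | h3
    · exact hu h3
    · exact hu ((dvd_sub_left (dvd_mul_right _ _)).1 h3)
  · intro h
    have h2 : (p : ℤ) ^ ((j + 1) / 2) ∣ a - (p : ℤ) ^ c :=
      dvd_sub h (pow_dvd_pow _ (by omega))
    refine (pow_dvd_pow _ ?_).trans ((pow_add (p : ℤ) ((j + 1) / 2) ((j + 1) / 2)) ▸
      mul_dvd_mul h h2)
    omega

lemma Int.pow_dvd_mul_sub_pow_of_lt {p : ℕ} (hp : p.Prime) {j c : ℕ} (hj : 2 * c < j)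
    (a : ℤ) :
    (p : ℤ) ^ j ∣ a * (a - (p : ℤ) ^ c) ↔
      (p : ℤ) ^ (j - c) ∣ a ∨ (p : ℤ) ^ (j - c) ∣ a - (p : ℤ) ^ c := by
  have hp' := Nat.prime_iff_prime_int.1 hp
  have hpc : (p : ℤ) ^ c ≠ 0 := pow_ne_zero _ hp'.ne_zero
  have e0 : (p : ℤ) ^ (j - c) = (p : ℤ) ^ c * (p : ℤ) ^ (j - 2 * c) := by
    rw [← pow_add]; congr 1; omega
  have e1 : (p : ℤ) ^ j = (p : ℤ) ^ c * ((p : ℤ) ^ c * (p : ℤ) ^ (j - 2 * c)) := by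
    rw [← e0, ← pow_add]; congr 1; omega
  constructor
  · intro h
    have hca : (p : ℤ) ^ c ∣ a := by
      have := (Int.pow_dvd_mul_sub_pow_of_le hp (le_refl (2 * c)) a).1
        ((pow_dvd_pow _ hj.le).trans h)
      rwa [show (2 * c + 1) / 2 = c by omega] at this
    obtain ⟨u, rfl⟩ := hca
    rw [e1, show (p : ℤ) ^ c * u * ((p : ℤ) ^ c * u - (p : ℤ) ^ c) =
      (p : ℤ) ^ c * ((p : ℤ) ^ c * (u * (u - 1))) by ring,
      mul_dvd_mul_iff_left hpc, mul_dvd_mul_iff_left hpc] at h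
    rw [e0, show (p : ℤ) ^ c * u - (p : ℤ) ^ c = (p : ℤ) ^ c * (u - 1) by ring,
      mul_dvd_mul_iff_left hpc, mul_dvd_mul_iff_left hpc]
    by_cases hu : (p : ℤ) ∣ u
    · left
      have : IsCoprime ((p : ℤ) ^ (j - 2 * c)) (u - 1) := by
        refine (hp'.coprime_iff_not_dvd.2 fun h1 => ?_).pow_left
        have := dvd_sub hu h1
        rw [sub_sub_cancel] at this
        exact hp'.not_dvd_one this
      exact this.dvd_of_dvd_mul_right h
    · right
      exact (hp'.coprime_iff_not_dvd.2 hu).pow_left.dvd_of_dvd_mul_left h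
  · rw [show (p : ℤ) ^ j = (p : ℤ) ^ (j - c) * (p : ℤ) ^ c by rw [← pow_add]; congr 1; omega]
    rintro (h | h)
    · have : (p : ℤ) ^ c ∣ a - (p : ℤ) ^ c :=
        dvd_sub ((pow_dvd_pow _ (by omega)).trans h) dvd_rfl
      exact mul_dvd_mul h this
    · have : (p : ℤ) ^ c ∣ a := by
        have := dvd_add ((pow_dvd_pow (p : ℤ) (show c ≤ j - c by omega)).trans h)
          (dvd_refl ((p : ℤ) ^ c))
        simpa using this
      rw [mul_comm a]
      exact mul_dvd_mul h this

/-- The number of roots in `[0, p ^ f)` of `X (X - p ^ c)` modulo `p ^ j` is polynomial in `p`. -/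
lemma exists_polynomial_card_pow_dvd_mul_sub_pow (f j c : ℕ) :
    ∃ T : Polynomial ℚ, ∀ p : ℕ, p.Prime →
      (((Finset.Ico (0 : ℤ) ((p : ℤ) ^ f)).filter fun a =>
        (p : ℤ) ^ j ∣ a * (a - (p : ℤ) ^ c)).card : ℚ) = T.eval (p : ℚ) := by
  rcases le_or_gt j (2 * c) with hj | hj
  · refine ⟨Polynomial.X ^ (f - (j + 1) / 2), fun p hp => ?_⟩
    simp only [Int.pow_dvd_mul_sub_pow_of_le hp hj]
    rw [card_Ico_pow_dvd_self hp]
    simp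
  · refine ⟨Polynomial.X ^ (f - (j - c)) +
      if c < f then Polynomial.X ^ (f - (j - c)) else 0, fun p hp => ?_⟩
    simp only [Int.pow_dvd_mul_sub_pow_of_lt hp hj]
    rw [Finset.filter_or, Finset.card_union_of_disjoint, card_Ico_pow_dvd_self hp,
      card_Ico_pow_dvd_sub_pow hp (show c < j - c by omega)]
    · split_ifs <;> simp
    · rw [Finset.disjoint_filter]
      intro a _ h1 h2
      have h3 := dvd_sub h1 h2
      rw [sub_sub_cancel] at h3
      have hp' := Nat.prime_iff_prime_int.1 hp
      have := (pow_dvd_pow_iff hp'.ne_zero hp'.not_isUnit).1 h3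
      omega

lemma exists_polynomial_card_pow_dvd (f k e : ℕ) (he : 0 < e) :
    ∃ T : Polynomial ℚ, ∀ p : ℕ, p.Prime →
      (((Finset.Ico (0 : ℤ) ((p : ℤ) ^ f)).filter fun a =>
        (p : ℤ) ^ k ∣ (p : ℤ) * a ^ 2 - (p : ℤ) ^ e * a).card : ℚ) = T.eval (p : ℚ) := by
  obtain ⟨c, rfl⟩ : ∃ c, e = c + 1 := ⟨e - 1, by omega⟩
  have e1 : ∀ (p : ℕ) (a : ℤ), (p : ℤ) * a ^ 2 - (p : ℤ) ^ (c + 1) * a =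
      p * (a * (a - (p : ℤ) ^ c)) := fun p a => by ring
  simp only [e1]
  cases k with
  | zero => exact ⟨Polynomial.X ^ f, fun p hp => by
    simpa using congrArg (Nat.cast (R := ℚ)) (card_Ico_pow_dvd_self hp f 0)⟩
  | succ j =>
    obtain ⟨T, hT⟩ := exists_polynomial_card_pow_dvd_mul_sub_pow f j c
    refine ⟨T, fun p hp => ?_⟩
    rw [← hT p hp]
    have hp0 : (p : ℤ) ≠ 0 := by exact_mod_cast hp.ne_zero
    simp only [pow_succ', mul_dvd_mul_iff_left hp0]

/-- Functions of a prime `p` and an integer vector `y` that are combinations, with coefficients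
polynomial in `p`, of the indicators of `p ^ h` dividing all coordinates of `y` in `S`. -/
inductive IsDvdCombination {ι : Type*} (S : Finset ι) : (ℕ → (ι → ℤ) → ℚ) → Prop
  | zero : IsDvdCombination S fun _ _ => 0
  | add {F G : ℕ → (ι → ℤ) → ℚ} (hF : IsDvdCombination S F) (hG : IsDvdCombination S G) :
      IsDvdCombination S fun p y => F p y + G p y
  | indicator (h : ℕ) (P : Polynomial ℚ) : IsDvdCombination S fun p y =>
      P.eval (p : ℚ) * if ∀ s ∈ S, (p : ℤ) ^ h ∣ y s then 1 else 0
  | congr {F G : ℕ → (ι → ℤ) → ℚ} (hF : IsDvdCombination S F)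
      (hFG : ∀ p, p.Prime → ∀ y, F p y = G p y) : IsDvdCombination S G

namespace IsDvdCombination

variable {ι : Type*} {S : Finset ι}

lemma finset_sum {κ : Type*} (K : Finset κ) {F : κ → ℕ → (ι → ℤ) → ℚ}
    (hF : ∀ j ∈ K, IsDvdCombination S (F j)) :
    IsDvdCombination S fun p y => ∑ j ∈ K, F j p y := by
  classical
  induction K using Finset.induction_on with
  | empty => simpa using zero
  | insert j K hj ih =>
    refine ((hF j (by simp)).add (ih fun k hk => hF k (by simp [hk]))).congr fun p _ y => ?_
    rw [Finset.sum_insert hj]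

lemma exists_polynomial {F : ℕ → (ι → ℤ) → ℚ} (hF : IsDvdCombination ∅ F) :
    ∃ P : Polynomial ℚ, ∀ p : ℕ, p.Prime → ∀ y, F p y = P.eval (p : ℚ) := by
  induction hF with
  | zero => exact ⟨0, by simp⟩
  | add _ _ h1 h2 =>
    obtain ⟨P, hP⟩ := h1
    obtain ⟨Q, hQ⟩ := h2
    exact ⟨P + Q, fun p hp y => by simp [hP p hp, hQ p hp]⟩
  | indicator h P => exact ⟨P, by simp⟩
  | congr _ h1 h2 =>
    obtain ⟨P, hP⟩ := h2
    exact ⟨P, fun p hp y => by rw [← h1 p hp, hP p hp]⟩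

/-- The indicator of `p ^ (h + d)` being the greatest common divisor of `p ^ (h + f)` and the
coordinates in `S`, times a polynomial in `p`. -/
lemma exact_indicator (h : ℕ) {d f : ℕ} (hd : d ≤ f) (P : Polynomial ℚ) :
    IsDvdCombination S fun p y => P.eval (p : ℚ) *
      if (∀ s ∈ S, (p : ℤ) ^ (h + d) ∣ y s) ∧
        (d = f ∨ ¬ ∀ s ∈ S, (p : ℤ) ^ (h + d + 1) ∣ y s) then 1 else 0 := by
  rcases hd.eq_or_lt with rfl | hd
  · exact (indicator (h + d) P).congr fun p _ y => by simp
  · refine ((indicator (h + d) P).add (indicator (h + d + 1) (-P))).congr fun p _ y => ?_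
    by_cases h2 : ∀ s ∈ S, (p : ℤ) ^ (h + d + 1) ∣ y s
    · have h1 : ∀ s ∈ S, (p : ℤ) ^ (h + d) ∣ y s := fun s hs =>
        (pow_dvd_pow _ (Nat.le_succ _)).trans (h2 s hs)
      rw [if_pos h1, if_pos h2, if_neg fun h3 => h3.2.elim hd.ne fun h4 => h4 h2]
      simp
    · by_cases h1 : ∀ s ∈ S, (p : ℤ) ^ (h + d) ∣ y s
      · rw [if_pos h1, if_neg h2, if_pos ⟨h1, Or.inr h2⟩]
        simp
      · rw [if_neg h1, if_neg h2, if_neg fun h3 => h1 h3.1]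
        simp

end IsDvdCombination

/-- The number of rows with prescribed divisibility of the residual, as a function of the
unknowns `y`. -/
lemma isDvdCombination_card_coordBox {ι : Type*} [Fintype ι] [DecidableEq ι] {S : Finset ι}
    {i : ι} (hi : i ∉ S) (f e h : ℕ) (he : 0 < e) :
    IsDvdCombination S fun p y =>
      if ∀ s ∈ S, (p : ℤ) ^ h ∣ y s then
        (((coordBox (insert i S) ((p : ℤ) ^ f)).filter fun b => (p : ℤ) ^ (f + h) ∣
          ((p : ℤ) * b i ^ 2 - (p : ℤ) ^ e * b i) - ∑ s ∈ S, b s * y s).card : ℚ)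
      else 0 := by
  choose T hT using fun k => exists_polynomial_card_pow_dvd f k e he
  refine (IsDvdCombination.finset_sum (Finset.range (f + 1)) fun d hd =>
    IsDvdCombination.exact_indicator (S := S) h (Nat.lt_succ_iff.1 (Finset.mem_range.1 hd))
      (Polynomial.X ^ (f * S.card + d - f) * T (h + d))).congr fun p hp y => ?_
  have mono : ∀ {a b : ℕ}, a ≤ b → (∀ s ∈ S, (p : ℤ) ^ b ∣ y s) →
      ∀ s ∈ S, (p : ℤ) ^ a ∣ y s := fun hab H s hs => (pow_dvd_pow _ hab).trans (H s hs)
  split_ifs with h0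
  · obtain ⟨d, hd, h1, h2⟩ : ∃ d ≤ f, (∀ s ∈ S, (p : ℤ) ^ (h + d) ∣ y s) ∧
        (d = f ∨ ¬ ∀ s ∈ S, (p : ℤ) ^ (h + d + 1) ∣ y s) := by
      by_contra! hcon
      have : ∀ d ≤ f, ∀ s ∈ S, (p : ℤ) ^ (h + d) ∣ y s := by
        intro d
        induction d with
        | zero => exact fun _ => h0
        | succ d ih => exact fun hd => (hcon d (by omega) (ih (by omega))).2
      exact (hcon f le_rfl (this f le_rfl)).1 rfl
    rw [Finset.sum_eq_single_of_mem d (Finset.mem_range.2 (by omega)), if_pos ⟨h1, h2⟩]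
    · rw [Finset.card_filter, sum_coordBox_insert hi]
      have e1 : ∀ (b : ι → ℤ) (x : ℤ), ∑ s ∈ S, Function.update b i x s * y s =
          ∑ s ∈ S, b s * y s := fun b x => Finset.sum_congr rfl fun s hs => by
        rw [Function.update_of_ne (ne_of_mem_of_not_mem hs hi)]
      simp only [Function.update_self, e1]
      simp_rw [← Finset.card_filter, card_coordBox_pow_dvd hp hd S y h1 h2]
      rw [← Finset.sum_filter, Finset.sum_const]
      simp only [Polynomial.eval_mul, Polynomial.eval_pow, Polynomial.eval_X, ← hT _ p hp]
      simp [mul_comm]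
    · intro d' hd' hne
      rw [if_neg, mul_zero]
      rintro ⟨h3, h4⟩
      rw [Finset.mem_range] at hd'
      rcases hne.lt_or_gt with hlt | hlt
      · exact h4.elim (by omega) fun h5 => h5 (mono (by omega) h1)
      · exact h2.elim (by omega) fun h5 => h5 (mono (by omega) h3)
  · refine Finset.sum_eq_zero fun d _ => ?_
    rw [if_neg, mul_zero]
    exact fun h3 => h0 (mono (by omega) h3.1)

lemma ite_dvd_indicator_update {ι : Type*} [DecidableEq ι] {S : Finset ι} {k : ι}
    (hk : k ∉ S) {p f : ℕ} (hpf : (p : ℤ) ^ f ≠ 0) (P : Polynomial ℚ) (h : ℕ) (y : ι → ℤ)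
    (r : ℤ) :
    (if (p : ℤ) ^ f ∣ r then P.eval (p : ℚ) *
      (if ∀ s ∈ insert k S, (p : ℤ) ^ h ∣ Function.update y k (r / (p : ℤ) ^ f) s
        then 1 else 0) else 0) =
      P.eval (p : ℚ) * if ∀ s ∈ S, (p : ℤ) ^ h ∣ y s then
        (if (p : ℤ) ^ (f + h) ∣ r then 1 else 0) else 0 := by
  by_cases hr : (p : ℤ) ^ f ∣ r
  · obtain ⟨c, rfl⟩ := hr
    have hy : (∀ s ∈ S, (p : ℤ) ^ h ∣ Function.update y k c s) ↔
        ∀ s ∈ S, (p : ℤ) ^ h ∣ y s := forall₂_congr fun s hs => by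
      rw [Function.update_of_ne (ne_of_mem_of_not_mem hs hk)]
    rw [if_pos (dvd_mul_right _ _), Int.mul_ediv_cancel_left _ hpf]
    simp only [pow_add, mul_dvd_mul_iff_left hpf, Finset.forall_mem_insert,
      Function.update_self, hy]
    rw [← ite_and]
    simp only [and_comm]
  · have hr' : ¬ (p : ℤ) ^ (f + h) ∣ r := fun h1 =>
      hr ((pow_dvd_pow _ (Nat.le_add_right _ _)).trans h1)
    simp [hr, hr']

/-- Summing over one row of the matrix and solving for the corresponding unknown preserves
combinations of divisibility indicators. -/
lemma IsDvdCombination.sum_row {ι : Type*} [Fintype ι] [DecidableEq ι] {S : Finset ι}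
    {i k : ι} (hi : i ∉ S) (hk : k ∉ S) (f e : ℕ) (he : 0 < e) {F : ℕ → (ι → ℤ) → ℚ}
    (hF : IsDvdCombination (insert k S) F) :
    IsDvdCombination S fun p y =>
      ∑ b ∈ coordBox (insert i S) ((p : ℤ) ^ f),
        if (p : ℤ) ^ f ∣ ((p : ℤ) * b i ^ 2 - (p : ℤ) ^ e * b i) - ∑ s ∈ S, b s * y s then
          F p (Function.update y k
            ((((p : ℤ) * b i ^ 2 - (p : ℤ) ^ e * b i) - ∑ s ∈ S, b s * y s) / (p : ℤ) ^ f))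
        else 0 := by
  induction hF with
  | zero => simpa using IsDvdCombination.zero
  | add _ _ h1 h2 =>
    refine (h1.add h2).congr fun p _ y => ?_
    rw [← Finset.sum_add_distrib]
    refine Finset.sum_congr rfl fun b _ => ?_
    split_ifs <;> simp
  | congr _ h1 h2 =>
    refine h2.congr fun p hp y => Finset.sum_congr rfl fun b _ => ?_
    simp only [h1 p hp]
  | indicator h P =>
    have aux := isDvdCombination_card_coordBox hi f e h he
    have smul : ∀ {G : ℕ → (ι → ℤ) → ℚ}, IsDvdCombination S G →
        IsDvdCombination S fun p y => P.eval (p : ℚ) * G p y := by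
      intro G hG
      induction hG with
      | zero => simpa using IsDvdCombination.zero
      | add _ _ h1 h2 => exact (h1.add h2).congr fun p _ y => by ring
      | congr _ h1 h2 => exact h2.congr fun p hp y => by rw [h1 p hp]
      | indicator h Q =>
        exact (IsDvdCombination.indicator h (P * Q)).congr fun p _ y => by
          rw [Polynomial.eval_mul, mul_assoc]
    refine (smul aux).congr fun p hp y => ?_
    have hpf : (p : ℤ) ^ f ≠ 0 := pow_ne_zero _ (by exact_mod_cast hp.ne_zero)
    refine Eq.trans ?_ (Finset.sum_congr rfl fun b _ => (ite_dvd_indicator_update hk hpf P _ y _).symm)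
    rw [← Finset.mul_sum, Finset.card_filter]
    split_ifs <;> simp

/-- After cancelling the common factor `p`, rows `r < k` of the system expressing `vᵢ ∘ vᵢ`
through the columns are solvable by an `x` agreeing with `y` from index `k` on. -/
def RowsSolvable (p : ℕ) {m : ℕ} (e : Fin m → ℕ) (i : Fin m) (k : ℕ) (a : Fin m → Fin m → ℤ)
    (y : Fin m → ℤ) : Prop :=
  ∃ x : Fin m → ℤ, (∀ s : Fin m, k ≤ s → x s = y s) ∧ ∀ r : Fin m, (r : ℕ) < k →
    (p : ℤ) ^ (e r - 1) * x r + ∑ s ∈ Finset.Ioo r i, a r s * x s =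
      (p : ℤ) * a r i ^ 2 - (p : ℤ) ^ e i * a r i

lemma rowsSolvable_succ {p : ℕ} (hp : p.Prime) {m : ℕ} (e : Fin m → ℕ) (i k : Fin m)
    (a : Fin m → Fin m → ℤ) (b y : Fin m → ℤ) :
    RowsSolvable p e i (k + 1) (Function.update a k b) y ↔
      (p : ℤ) ^ (e k - 1) ∣ ((p : ℤ) * b i ^ 2 - (p : ℤ) ^ e i * b i) -
        ∑ s ∈ Finset.Ioo k i, b s * y s ∧
      RowsSolvable p e i k a (Function.update y k
        ((((p : ℤ) * b i ^ 2 - (p : ℤ) ^ e i * b i) - ∑ s ∈ Finset.Ioo k i, b s * y s) /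
          (p : ℤ) ^ (e k - 1))) := by
  have hpf : (p : ℤ) ^ (e k - 1) ≠ 0 := pow_ne_zero _ (by exact_mod_cast hp.ne_zero)
  have hsum : ∀ x : Fin m → ℤ, (∀ s : Fin m, (k : ℕ) + 1 ≤ s → x s = y s) →
      ∑ s ∈ Finset.Ioo k i, b s * x s = ∑ s ∈ Finset.Ioo k i, b s * y s := fun x hx =>
    Finset.sum_congr rfl fun s hs => by
      rw [hx s (Nat.succ_le_of_lt (Fin.lt_def.1 (Finset.mem_Ioo.1 hs).1))]
  constructor
  · rintro ⟨x, hx, hrow⟩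
    have hk := hrow k (Nat.lt_succ_self _)
    rw [Function.update_self, hsum x hx] at hk
    have hk' := eq_sub_of_add_eq hk
    refine ⟨⟨x k, hk'.symm⟩, x, fun s hs => ?_, fun r hr => ?_⟩
    · rcases eq_or_ne s k with rfl | hsk
      · rw [← hk', Int.mul_ediv_cancel_left _ hpf, Function.update_self]
      · rw [Function.update_of_ne hsk, hx s]
        have := Fin.val_ne_of_ne hsk
        omega
    · have := hrow r (by omega)
      rwa [Function.update_of_ne (Fin.ne_of_lt (Fin.lt_def.2 hr))] at this
  · rintro ⟨⟨c, hc⟩, x, hx, hrow⟩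
    rw [hc, Int.mul_ediv_cancel_left _ hpf] at hx
    have hx' : ∀ s : Fin m, (k : ℕ) + 1 ≤ s → x s = y s := fun s hs => by
      rw [hx s (by omega), Function.update_of_ne]
      rintro rfl
      omega
    refine ⟨x, hx', fun r hr => ?_⟩
    rcases eq_or_ne r k with rfl | hrk
    · have hxr := hx r le_rfl
      rw [Function.update_self] at hxr
      rw [Function.update_self, hsum x hx', hxr, ← hc]
      ring
    · rw [Function.update_of_ne hrk]
      have := Fin.val_ne_of_ne hrk
      exact hrow r (by omega)

/-- Parameter families that are supported on the rows `r < k`. -/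
noncomputable def paramBox (p : ℕ) {m : ℕ} (e : Fin m → ℕ) (i : Fin m) (k : ℕ) :
    Finset (Fin m → Fin m → ℤ) :=
  Fintype.piFinset fun r : Fin m =>
    if (r : ℕ) < k then coordBox (Finset.Ioc r i) ((p : ℤ) ^ (e r - 1)) else {0}

lemma mem_paramBox {p : ℕ} (hp : p.Prime) {m : ℕ} (e : Fin m → ℕ) (i : Fin m)
    (a : Fin m → Fin m → ℤ) :
    a ∈ paramBox p e i i ↔ (∀ r s : Fin m, 0 ≤ a r s ∧ a r s < (p : ℤ) ^ (e r - 1)) ∧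
      ∀ r s : Fin m, ¬((r : ℕ) < (s : ℕ) ∧ (s : ℕ) ≤ (i : ℕ)) → a r s = 0 := by
  have hpos : ∀ r, (0 : ℤ) < (p : ℤ) ^ (e r - 1) := fun r =>
    pow_pos (by exact_mod_cast hp.pos) _
  have hrow : ∀ r : Fin m, (a r ∈ if (r : ℕ) < i then
      coordBox (Finset.Ioc r i) ((p : ℤ) ^ (e r - 1)) else {0}) ↔
      ∀ s : Fin m, if (r : ℕ) < s ∧ (s : ℕ) ≤ i then 0 ≤ a r s ∧ a r s < (p : ℤ) ^ (e r - 1)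
        else a r s = 0 := by
    intro r
    split_ifs with hr
    · rw [coordBox, Fintype.mem_piFinset]
      refine forall_congr' fun s => ?_
      simp only [Finset.mem_Ioc, Fin.lt_def, Fin.le_def]
      split_ifs <;> simp
    · rw [Finset.mem_singleton, funext_iff]
      refine forall_congr' fun s => ?_
      rw [if_neg (by omega), Pi.zero_apply]
  rw [paramBox, Fintype.mem_piFinset, forall_congr' hrow, ← forall_and]
  refine forall_congr' fun r => ?_
  rw [← forall_and]
  refine forall_congr' fun s => ?_
  split_ifs with h
  · simp [h]
  · simp only [h, not_false_eq_true, forall_const]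
    exact ⟨fun h0 => ⟨by rw [h0]; exact ⟨le_rfl, hpos r⟩, h0⟩, And.right⟩

open Classical in
lemma isDvdCombination_card_rowsSolvable {m : ℕ} (e : Fin m → ℕ) (he : ∀ r, 0 < e r)
    (i : Fin m) (k : ℕ) (hk : k ≤ i) :
    IsDvdCombination (Finset.univ.filter fun s : Fin m => k ≤ s ∧ s < i) fun p y =>
      (((paramBox p e i k).filter fun a => RowsSolvable p e i k a y).card : ℚ) := by
  induction k with
  | zero =>
    refine (IsDvdCombination.indicator 0 1).congr fun p hp y => ?_
    have h1 : ∀ a, RowsSolvable p e i 0 a y := fun a =>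
      ⟨y, fun _ _ => rfl, fun r hr => absurd hr (Nat.not_lt_zero _)⟩
    simp [h1, paramBox]
  | succ k ih =>
    obtain ⟨k, rfl⟩ : ∃ k' : Fin m, (k' : ℕ) = k := ⟨⟨k, by omega⟩, rfl⟩
    have hki : k < i := Fin.lt_def.2 hk
    have e1 : (Finset.univ.filter fun s : Fin m => (k : ℕ) + 1 ≤ s ∧ s < i) =
        Finset.Ioo k i := by
      ext s
      simp only [Finset.mem_filter, Finset.mem_univ, true_and, Finset.mem_Ioo, Fin.lt_def,
        Nat.succ_le_iff]
    have e2 : (Finset.univ.filter fun s : Fin m => (k : ℕ) ≤ s ∧ s < i) =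
        insert k (Finset.Ioo k i) := by
      ext s
      simp only [Finset.mem_filter, Finset.mem_univ, true_and, Finset.mem_insert,
        Finset.mem_Ioo, Fin.lt_def, Fin.ext_iff] at hki ⊢
      omega
    have ih := ih (by omega)
    rw [e2] at ih
    rw [e1]
    refine (ih.sum_row (i := i) (by simp) (by simp) (e k - 1) (e i) (he i)).congr
      fun p hp y => ?_
    have e3 : Function.update (fun r : Fin m => if (r : ℕ) < k + 1 then
        coordBox (Finset.Ioc r i) ((p : ℤ) ^ (e r - 1)) else {0}) k {0} =
        fun r : Fin m => if (r : ℕ) < k then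
          coordBox (Finset.Ioc r i) ((p : ℤ) ^ (e r - 1)) else {0} := by
      ext1 r
      rcases eq_or_ne r k with rfl | hrk
      · simp
      · have := Fin.val_ne_of_ne hrk
        rw [Function.update_of_ne hrk]
        simp only [show (r : ℕ) < k + 1 ↔ (r : ℕ) < k by omega]
    have e4 : insert i (Finset.Ioo k i) = Finset.Ioc k i := Finset.Ioo_insert_right hki
    rw [Finset.card_filter]
    conv_rhs => rw [paramBox, sum_piFinset_update _ k 0, e3]
    rw [if_pos (Nat.lt_succ_self _), e4]
    push_cast
    refine Finset.sum_congr rfl fun b _ => ?_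
    simp only [rowsSolvable_succ hp]
    rw [Finset.card_filter]
    split_ifs with h <;> simp [h, paramBox]

lemma assocMatrix_castSucc_castSucc (p : ℕ) {m : ℕ} (e : Fin m → ℕ) (a : Fin m → Fin m → ℤ)
    (r s : Fin m) : assocMatrix p e a r.castSucc s.castSucc =
      if r = s then (p : ℤ) ^ e s else if r < s then p * a r s else 0 := by
  simp [assocMatrix, s.isLt.ne, Fin.ext_iff]

lemma assocMatrix_last_castSucc (p : ℕ) {m : ℕ} (e : Fin m → ℕ) (a : Fin m → Fin m → ℤ)
    (s : Fin m) : assocMatrix p e a (Fin.last m) s.castSucc = 0 := by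
  have h := Fin.castSucc_lt_last s
  simp [assocMatrix, s.isLt.ne, s.isLt.ne', h.not_gt]

lemma assocMatrix_mulVec_castSucc (p : ℕ) {m : ℕ} (e : Fin m → ℕ) (a : Fin m → Fin m → ℤ)
    (x : Fin (m + 1) → ℤ) (r : Fin m) :
    (assocMatrix p e a).mulVec x r.castSucc = (p : ℤ) ^ e r * x r.castSucc +
      ∑ s ∈ Finset.Ioi r, p * a r s * x s.castSucc + x (Fin.last m) := by
  have h1 : ∀ s : Fin m, assocMatrix p e a r.castSucc s.castSucc * x s.castSucc =
      (if s = r then (p : ℤ) ^ e r * x r.castSucc else 0) +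
        if s ∈ Finset.Ioi r then p * a r s * x s.castSucc else 0 := by
    intro s
    rw [assocMatrix_castSucc_castSucc]
    rcases lt_trichotomy r s with h | rfl | h
    · simp [h, h.ne, h.ne']
    · simp
    · simp [h.ne, h.ne', h.not_gt]
  have h2 : assocMatrix p e a r.castSucc (Fin.last m) = 1 := by simp [assocMatrix]
  rw [Matrix.mulVec, dotProduct, Fin.sum_univ_castSucc, h2, one_mul]
  simp only [h1, Finset.sum_add_distrib, Finset.sum_ite_mem, Finset.univ_inter]
  simp

lemma assocMatrix_mulVec_last (p : ℕ) {m : ℕ} (e : Fin m → ℕ) (a : Fin m → Fin m → ℤ)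
    (x : Fin (m + 1) → ℤ) : (assocMatrix p e a).mulVec x (Fin.last m) = x (Fin.last m) := by
  have h2 : assocMatrix p e a (Fin.last m) (Fin.last m) = 1 := by simp [assocMatrix]
  rw [Matrix.mulVec, dotProduct, Fin.sum_univ_castSucc, h2]
  simp [assocMatrix_last_castSucc]

lemma exists_mulVec_eq_iff_rowsSolvable {p : ℕ} (hp : p.Prime) {m : ℕ} (e : Fin m → ℕ)
    (he : ∀ r, 0 < e r) (i : Fin m) (a : Fin m → Fin m → ℤ)
    (ha : ∀ r s : Fin m, ¬((r : ℕ) < (s : ℕ) ∧ (s : ℕ) ≤ (i : ℕ)) → a r s = 0) :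
    (∃ x : Fin (m + 1) → ℤ, (assocMatrix p e a).mulVec x =
      fun t => assocMatrix p e a t i.castSucc * assocMatrix p e a t i.castSucc) ↔
    RowsSolvable p e i i a 0 := by
  have hp0 : (p : ℤ) ≠ 0 := by exact_mod_cast hp.ne_zero
  have hsum_ge : ∀ (r : Fin m) (x : Fin (m + 1) → ℤ), i ≤ r →
      ∑ s ∈ Finset.Ioi r, (p : ℤ) * a r s * x s.castSucc = 0 := fun r x hr =>
    Finset.sum_eq_zero fun s hs => by
      rw [ha r s]
      · ring
      · rw [Finset.mem_Ioi, Fin.lt_def] at hs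
        rw [Fin.le_def] at hr
        omega
  have hsum_lt : ∀ (r : Fin m) (x : Fin (m + 1) → ℤ), r < i →
      ∑ s ∈ Finset.Ioi r, (p : ℤ) * a r s * x s.castSucc =
        p * (∑ s ∈ Finset.Ioo r i, a r s * x s.castSucc + a r i * x i.castSucc) := by
    intro r x hr
    have hsub : Finset.Ioc r i ⊆ Finset.Ioi r := fun s hs =>
      Finset.mem_Ioi.2 (Finset.mem_Ioc.1 hs).1
    rw [← Finset.sum_subset hsub, ← Finset.Ioo_insert_right hr, Finset.sum_insert (by simp),
      mul_add, Finset.mul_sum, add_comm]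
    · simp only [mul_assoc]
    · intro s hs hs'
      rw [ha r s, mul_zero, zero_mul]
      rwa [Finset.mem_Ioc, Fin.lt_def, Fin.le_def] at hs'
  have hpow : ∀ r, (p : ℤ) ^ e r = p * (p : ℤ) ^ (e r - 1) := fun r => by
    rw [← pow_succ', Nat.sub_add_cancel (he r)]
  have hM_gt : ∀ r : Fin m, i < r → assocMatrix p e a r.castSucc i.castSucc = 0 :=
    fun r hr => by rw [assocMatrix_castSucc_castSucc, if_neg hr.ne', if_neg hr.not_gt]
  have hM_eq : assocMatrix p e a i.castSucc i.castSucc = (p : ℤ) ^ e i := by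
    rw [assocMatrix_castSucc_castSucc, if_pos rfl]
  have hM_lt : ∀ r : Fin m, r < i → assocMatrix p e a r.castSucc i.castSucc = p * a r i :=
    fun r hr => by rw [assocMatrix_castSucc_castSucc, if_neg hr.ne, if_pos hr]
  have hM_last := assocMatrix_last_castSucc p e a i
  constructor
  · rintro ⟨x, hx⟩
    have hlast := congrFun hx (Fin.last m)
    rw [assocMatrix_mulVec_last, hM_last, mul_zero] at hlast
    have hrow : ∀ r : Fin m, _ := fun r => congrFun hx r.castSucc
    simp only [assocMatrix_mulVec_castSucc, hlast, add_zero] at hrow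
    have hxi : x i.castSucc = (p : ℤ) ^ e i := by
      have := hrow i
      rw [hsum_ge i x le_rfl, hM_eq, add_zero] at this
      exact mul_left_cancel₀ (pow_ne_zero _ hp0) this
    refine ⟨fun s => if s < i then x s.castSucc else 0, fun s hs => ?_, fun r hr => ?_⟩
    · exact if_neg (not_lt.2 (Fin.le_def.2 hs))
    · have hr' : r < i := Fin.lt_def.2 hr
      have := hrow r
      rw [hsum_lt r x hr', hM_lt r hr', hxi, hpow r] at this
      have e1 : ∑ s ∈ Finset.Ioo r i, a r s * (if s < i then x s.castSucc else 0) =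
          ∑ s ∈ Finset.Ioo r i, a r s * x s.castSucc := Finset.sum_congr rfl fun s hs => by
        rw [if_pos (Finset.mem_Ioo.1 hs).2]
      rw [e1]
      simp only [hr', if_true]
      refine mul_left_cancel₀ hp0 ?_
      linear_combination this
  · rintro ⟨x, hx, hrow⟩
    refine ⟨Fin.snoc (Function.update x i ((p : ℤ) ^ e i)) 0, funext fun t => ?_⟩
    refine Fin.lastCases ?_ (fun r => ?_) t
    · rw [assocMatrix_mulVec_last, hM_last, Fin.snoc_last, mul_zero]
    · rw [assocMatrix_mulVec_castSucc, Fin.snoc_last, add_zero]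
      rcases lt_trichotomy r i with hr | rfl | hr
      · rw [hsum_lt r _ hr, hM_lt r hr]
        simp only [Fin.snoc_castSucc, Function.update_self]
        have e1 : ∑ s ∈ Finset.Ioo r i, a r s * Function.update x i ((p : ℤ) ^ e i) s =
            ∑ s ∈ Finset.Ioo r i, a r s * x s := Finset.sum_congr rfl fun s hs => by
          rw [Function.update_of_ne (Finset.mem_Ioo.1 hs).2.ne]
        rw [e1, Function.update_of_ne hr.ne, hpow r]
        linear_combination (p : ℤ) * hrow r (Fin.lt_def.1 hr)
      · rw [hsum_ge r _ le_rfl, hM_eq]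
        simp
      · rw [hsum_ge r _ hr.le, hM_gt r hr]
        simp [hr.ne', hx r (Fin.lt_def.1 hr).le]

/-- Proposition `vivi_poly` of the paper: fix `n = m+1 ≥ 2`, positive integers
`e₁, …, e_m`, and an index `i`.  For each prime `p`, the number of tuples
`(a_{rs})_{1 ≤ r < s ≤ i}` with `0 ≤ a_{rs} < p^{e_r - 1}` such that `vᵢ ∘ vᵢ` lies in
the `ℤ`-span of the columns of the associated matrix `A` is a polynomial in `p`
(tuples are modeled as families `a : Fin m → Fin m → ℤ` vanishing outside the
index set `{(r,s) : r < s ≤ i}`). -/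
theorem count_vivi_polynomial (m : ℕ) (hm : 1 ≤ m) (e : Fin m → ℕ)
    (he : ∀ r, 0 < e r) (i : Fin m) :
    ∃ P : Polynomial ℚ, ∀ p : ℕ, p.Prime →
      (Nat.card {a : Fin m → Fin m → ℤ //
        (∀ r s : Fin m, 0 ≤ a r s ∧ a r s < (p : ℤ) ^ (e r - 1)) ∧
        (∀ r s : Fin m, ¬((r : ℕ) < (s : ℕ) ∧ (s : ℕ) ≤ (i : ℕ)) → a r s = 0) ∧
        (∃ x : Fin (m + 1) → ℤ, (assocMatrix p e a).mulVec x =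
          fun t => assocMatrix p e a t i.castSucc * assocMatrix p e a t i.castSucc)} : ℚ)
        = P.eval (p : ℚ) := by
  classical
  have hempty : (Finset.univ.filter fun s : Fin m => (i : ℕ) ≤ s ∧ s < i) = ∅ := by
    ext s
    simp
  have hcomb := isDvdCombination_card_rowsSolvable e he i i le_rfl
  rw [hempty] at hcomb
  obtain ⟨P, hP⟩ := hcomb.exists_polynomial
  refine ⟨P, fun p hp => ?_⟩
  rw [← hP p hp 0, Nat.subtype_card]
  intro a
  rw [Finset.mem_filter, mem_paramBox hp, and_assoc]
  exact and_congr_right fun _ => and_congr_right fun ha =>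
    (exists_mulVec_eq_iff_rowsSolvable hp e he i a ha).symm
end

section
/- Let $p$ be a prime and $m\ge 0$ an integer. The number of tuples $(a,b,c_1,\dots,c_m)\in\mathbb{F}_p^{m+2}$ satisfying $a(c_i^2-c_i)=0$ and $b(c_i^2-c_i)=0$ for all $1\le i\le m$, and $a\,c_ic_j=0$ and $b\,c_ic_j=0$ for all $1\le i<j\le m$, is exactly $p^{m} + (m+1)(p^2-1)$. -/
/-- The orthogonal idempotent vectors are exactly zero and the standard basis vectors. -/
theorem orthogonal_idempotents_iff {K ι : Type*} [Field K] [LinearOrder ι] (c : ι → K) :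
    ((∀ i, c i ^ 2 - c i = 0) ∧ ∀ i j, i < j → c i * c j = 0) ↔
      ∃ o : Option ι, o.elim 0 (fun k => Pi.single k 1) = c := by
  constructor
  · rintro ⟨h, h'⟩
    by_cases hc : ∃ k, c k ≠ 0
    · obtain ⟨k, hk⟩ := hc
      refine ⟨some k, funext fun i => ?_⟩
      rcases lt_trichotomy i k with hi | rfl | hi
      · have := h' i k hi
        simp_all [Pi.single_eq_of_ne hi.ne]
      · have h1 : c i * (c i - 1) = 0 := by linear_combination h i
        have h2 := (mul_eq_zero.mp h1).resolve_left hk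
        simp [sub_eq_zero.mp h2]
      · have := h' k i hi
        simp_all [Pi.single_eq_of_ne hi.ne']
    · push Not at hc
      exact ⟨none, funext fun i => (hc i).symm⟩
  · rintro ⟨_ | k, rfl⟩
    · simp
    · refine ⟨fun i => ?_, fun i j hij => ?_⟩
      · by_cases hi : i = k <;> simp [hi]
      · by_cases hi : i = k
        · simp [Pi.single_apply, (hi ▸ hij).ne']
        · simp [Pi.single_apply, hi]

theorem injective_option_elim_single {K ι : Type*} [Field K] [DecidableEq ι] :
    Function.Injective
      (fun o : Option ι => (o.elim 0 (fun k => Pi.single k 1) : ι → K)) := by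
  rintro (_ | k) (_ | l) h
  · rfl
  · simpa using congrFun h l
  · simpa using congrFun h k
  · by_contra hkl
    have : k ≠ l := fun e => hkl (congrArg some e)
    simpa [Pi.single_apply, this] using congrFun h k

theorem card_orthogonal_idempotents {K ι : Type*} [Field K] [LinearOrder ι] [Fintype ι] :
    Nat.card {c : ι → K // (∀ i, c i ^ 2 - c i = 0) ∧ ∀ i j, i < j → c i * c j = 0} =
      Fintype.card ι + 1 := by
  rw [Nat.card_congr (Equiv.subtypeEquivRight orthogonal_idempotents_iff)]
  exact (Nat.card_congr (Equiv.ofInjective _ injective_option_elim_single)).symm.trans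
    (by simp)

/-- Core point count for Claim 1 in the proof of Lemma `lemma222`: for a prime `p` and
`m ≥ 0`, the number of tuples `(a, b, c₁, …, c_m) ∈ 𝔽_p^{m+2}` with
`a(cᵢ² - cᵢ) = 0` and `b(cᵢ² - cᵢ) = 0` for all `i`, and `a·cᵢcⱼ = 0` and
`b·cᵢcⱼ = 0` for all `i < j`, is exactly `p^m + (m+1)(p² - 1)`. -/
theorem point_count_claim1 (p : ℕ) (hp : p.Prime) (m : ℕ) :
    Nat.card {t : ZMod p × ZMod p × (Fin m → ZMod p) //
      (∀ i : Fin m, t.1 * ((t.2.2 i) ^ 2 - t.2.2 i) = 0) ∧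
      (∀ i : Fin m, t.2.1 * ((t.2.2 i) ^ 2 - t.2.2 i) = 0) ∧
      (∀ i j : Fin m, i < j → t.1 * (t.2.2 i * t.2.2 j) = 0) ∧
      (∀ i j : Fin m, i < j → t.2.1 * (t.2.2 i * t.2.2 j) = 0)} =
    p ^ m + (m + 1) * (p ^ 2 - 1) := by
  have : Fact p.Prime := ⟨hp⟩
  let S : Set (Fin m → ZMod p) :=
    {c | (∀ i, c i ^ 2 - c i = 0) ∧ ∀ i j, i < j → c i * c j = 0}
  let e := (Equiv.prodAssoc (ZMod p) (ZMod p) (Fin m → ZMod p)).symm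
  have hS : S.ncard = m + 1 := by
    rw [← Nat.card_coe_set_eq]
    exact card_orthogonal_idempotents.trans (by simp)
  have hcompl : ({0}ᶜ : Set (ZMod p × ZMod p)).ncard = p ^ 2 - 1 := by
    rw [Set.ncard_compl]
    simp [sq]
  have hdisj : Disjoint (({0} : Set (ZMod p × ZMod p)) ×ˢ (Set.univ : Set (Fin m → ZMod p)))
      ({0}ᶜ ×ˢ S) :=
    Set.disjoint_prod.mpr (Or.inl disjoint_compl_right)
  have hcard : (({0} : Set (ZMod p × ZMod p)) ×ˢ (Set.univ : Set (Fin m → ZMod p)) ∪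
      {0}ᶜ ×ˢ S).ncard = p ^ m + (m + 1) * (p ^ 2 - 1) := by
    rw [Set.ncard_union_eq hdisj, Set.ncard_prod, Set.ncard_prod, hS, hcompl]
    simp [Set.ncard_univ, mul_comm]
  rw [← hcard, ← Nat.card_coe_set_eq]
  refine Nat.card_congr (e.subtypeEquiv ?_)
  rintro ⟨a, b, c⟩
  by_cases ha : a = 0 <;> by_cases hb : b = 0 <;> simp [e, S, ha, hb]
end

section
/- Let $p$ be a prime. The number of tuples $(a_1,a_2,a_3,a_4,a_5)\in\mathbb{F}_p^5$ satisfying $a_2^2 = a_1a_4^2$ and $a_3^2 = a_1a_5^2$ equals $p^3$ if $p=2$, and equals $2p^3-3p^2+3p-1$ if $p>2$. In particular, this point count is quasipolynomial but not polynomial in $p$. -/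
/-- The number of points of the affine curve `x ^ 2 = a * y ^ 2` over a finite field of odd
characteristic. -/
theorem card_sq_eq_mul_sq {F : Type*} [Field F] [Fintype F] [DecidableEq F]
    (hF : ringChar F ≠ 2) (a : F) :
    (Nat.card {q : F × F // q.1 ^ 2 = a * q.2 ^ 2} : ℤ) =
      Fintype.card F + (Fintype.card F - 1) * quadraticChar F a := by
  have fiber (y : F) : (Nat.card {x : F // x ^ 2 = a * y ^ 2} : ℤ) =
      quadraticChar F (a * y ^ 2) + 1 := by
    rw [← quadraticChar_card_sqrts hF, Nat.card_eq_fintype_card, Set.toFinset_card]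
    rfl
  let e : {q : F × F // q.1 ^ 2 = a * q.2 ^ 2} ≃ Σ y : F, {x : F // x ^ 2 = a * y ^ 2} :=
    { toFun := fun q => ⟨q.1.2, q.1.1, q.2⟩
      invFun := fun s => ⟨(s.2.1, s.1), s.2.2⟩ }
  rw [Nat.card_congr e, Nat.card_sigma]
  push_cast
  simp only [fiber]
  rw [← Finset.add_sum_erase _ _ (Finset.mem_univ (0 : F)), Finset.sum_congr rfl
    (g := fun _ => quadraticChar F a + 1), Finset.sum_const,
    Finset.card_erase_of_mem (Finset.mem_univ _), Finset.card_univ, nsmul_eq_mul,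
    Nat.cast_sub Fintype.card_pos]
  · simp
    ring
  · intro y hy
    rw [map_mul, quadraticChar_sq_one' (Finset.ne_of_mem_erase hy), mul_one]

theorem sum_quadraticChar_sq {F : Type*} [Field F] [Fintype F] [DecidableEq F] :
    ∑ a : F, quadraticChar F a ^ 2 = (Fintype.card F : ℤ) - 1 := by
  rw [← Finset.add_sum_erase _ _ (Finset.mem_univ (0 : F)), Finset.sum_congr rfl
    (g := fun _ => (1 : ℤ)), Finset.sum_const,
    Finset.card_erase_of_mem (Finset.mem_univ _), Finset.card_univ, nsmul_eq_mul,
    Nat.cast_sub Fintype.card_pos]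
  · simp
  · intro y hy
    exact quadraticChar_sq_one (Finset.ne_of_mem_erase hy)

/-- The points of the threefold, fibred over the coordinate `a₁`. -/
def threefoldEquivSigma (F : Type*) [Field F] :
    {v : Fin 5 → F // (v 1) ^ 2 = v 0 * (v 3) ^ 2 ∧ (v 2) ^ 2 = v 0 * (v 4) ^ 2} ≃
      Σ a : F, {q : F × F // q.1 ^ 2 = a * q.2 ^ 2} × {q : F × F // q.1 ^ 2 = a * q.2 ^ 2} where
  toFun v := ⟨v.1 0, ⟨(v.1 1, v.1 3), v.2.1⟩, ⟨(v.1 2, v.1 4), v.2.2⟩⟩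
  invFun s := ⟨![s.1, s.2.1.1.1, s.2.2.1.1, s.2.1.1.2, s.2.2.1.2], s.2.1.2, s.2.2.2⟩
  left_inv v := by
    ext i
    fin_cases i <;> rfl
  right_inv _ := rfl

theorem card_threefold_of_ringChar_ne_two {F : Type*} [Field F] [Fintype F]
    (hF : ringChar F ≠ 2) :
    (Nat.card {v : Fin 5 → F //
        (v 1) ^ 2 = v 0 * (v 3) ^ 2 ∧ (v 2) ^ 2 = v 0 * (v 4) ^ 2} : ℤ) =
      2 * (Fintype.card F : ℤ) ^ 3 - 3 * (Fintype.card F : ℤ) ^ 2 +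
        3 * (Fintype.card F : ℤ) - 1 := by
  classical
  rw [Nat.card_congr (threefoldEquivSigma F), Nat.card_sigma]
  simp only [Nat.card_prod]
  push_cast
  simp only [card_sq_eq_mul_sq hF]
  set n : ℤ := (Fintype.card F : ℤ)
  calc ∑ a : F, (n + (n - 1) * quadraticChar F a) * (n + (n - 1) * quadraticChar F a)
      = ∑ a : F, (n ^ 2 + 2 * n * (n - 1) * quadraticChar F a +
          (n - 1) ^ 2 * quadraticChar F a ^ 2) := by
        refine Finset.sum_congr rfl fun a _ => ?_
        ring
    _ = n * n ^ 2 + 2 * n * (n - 1) * 0 + (n - 1) ^ 2 * (n - 1) := by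
        rw [Finset.sum_add_distrib, Finset.sum_add_distrib, ← Finset.mul_sum, ← Finset.mul_sum,
          quadraticChar_sum_zero hF, sum_quadraticChar_sq, Finset.sum_const, Finset.card_univ,
          nsmul_eq_mul]
    _ = 2 * n ^ 3 - 3 * n ^ 2 + 3 * n - 1 := by ring

theorem card_threefold_zmod_two :
    Nat.card {v : Fin 5 → ZMod 2 //
      (v 1) ^ 2 = v 0 * (v 3) ^ 2 ∧ (v 2) ^ 2 = v 0 * (v 4) ^ 2} = 8 := by
  rw [Nat.card_eq_fintype_card]
  decide +kernel

theorem card_threefold_zmod (p : ℕ) (hp : p.Prime) (h2 : p ≠ 2) :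
    (Nat.card {v : Fin 5 → ZMod p //
        (v 1) ^ 2 = v 0 * (v 3) ^ 2 ∧ (v 2) ^ 2 = v 0 * (v 4) ^ 2} : ℤ) =
      2 * (p : ℤ) ^ 3 - 3 * (p : ℤ) ^ 2 + 3 * (p : ℤ) - 1 := by
  have := Fact.mk hp
  rw [card_threefold_of_ringChar_ne_two (by rwa [ZMod.ringChar_zmod_n]), ZMod.card]


/-- The number of `𝔽_p`-points of `V(-a₁a₄² + a₂², -a₁a₅² + a₃²) ⊆ 𝔸⁵`:
it equals `p³` if `p = 2` and `2p³ - 3p² + 3p - 1` if `p > 2`; in particular this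
count is quasipolynomial but not polynomial in `p`. -/
theorem point_count_not_polynomial :
    (∀ p : ℕ, p.Prime →
      (Nat.card {v : Fin 5 → ZMod p //
          (v 1) ^ 2 = v 0 * (v 3) ^ 2 ∧ (v 2) ^ 2 = v 0 * (v 4) ^ 2} : ℤ) =
        if p = 2 then (p : ℤ) ^ 3
        else 2 * (p : ℤ) ^ 3 - 3 * (p : ℤ) ^ 2 + 3 * (p : ℤ) - 1) ∧
    ¬ ∃ P : Polynomial ℚ, ∀ p : ℕ, p.Prime →
      (Nat.card {v : Fin 5 → ZMod p //
          (v 1) ^ 2 = v 0 * (v 3) ^ 2 ∧ (v 2) ^ 2 = v 0 * (v 4) ^ 2} : ℚ) =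
        P.eval (p : ℚ) := by
  refine ⟨fun p hp => ?_, ?_⟩
  · split_ifs with h
    · subst h
      rw [card_threefold_zmod_two]
      norm_num
    · exact card_threefold_zmod p hp h
  · rintro ⟨P, hP⟩
    let Q : Polynomial ℚ := 2 * .X ^ 3 - 3 * .X ^ 2 + 3 * .X - 1
    have hQ (p : ℕ) : Q.eval (p : ℚ) = 2 * (p : ℚ) ^ 3 - 3 * (p : ℚ) ^ 2 + 3 * (p : ℚ) - 1 := by
      simp [Q]
    have hinf : ((fun n : ℕ => (n : ℚ)) '' ({p : ℕ | p.Prime} \ {2})).Infinite :=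
      (Nat.infinite_setOfPred_prime.sdiff (Set.finite_singleton 2)).image Nat.cast_injective.injOn
    have hPQ : P = Q := by
      refine Polynomial.eq_of_infinite_eval_eq P Q (hinf.mono ?_)
      rintro _ ⟨p, ⟨hp, h2⟩, rfl⟩
      rw [Set.mem_ofPred_eq, ← hP p hp, hQ]
      exact_mod_cast congrArg (Int.cast : ℤ → ℚ) (card_threefold_zmod p hp h2)
    have h := hP 2 Nat.prime_two
    rw [card_threefold_zmod_two, hPQ, hQ] at h
    norm_num at h
end
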